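/- Fix α > 0. For every T > 0 there exists a constant c > 0 such that for all n ∈ ℕ (n ≥ 1), all (x,y) ∈ V and all t ∈ [0,T]: (α/n) ∫₀^{tn²} (e^{s𝐁_n} 𝟙_U)((x,y)) ds ≤ c. (This quantity equals the expected number of jumps across edges of 𝒰 — the slow edges, each of rate α/n — performed up to time tn² by the continuous-time random walk generated by 𝐁_n started at (x,y), since each vertex of U is an endpoint of exactly one edge of 𝒰.) -/

import Mathlib

open MeasureTheory Filter
open scoped BoundedContinuousFunction NNReal

/-- `p` lies in `V = {(x,y) : y ≥ x+1}`. -/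
def inV (p : ℤ × ℤ) : Prop := p.1 + 1 ≤ p.2

/-- `p` lies in the set `U` of vertices attached to the slow edges. -/
def inU (p : ℤ × ℤ) : Prop :=
  inV p ∧ (((p.1 = 0 ∨ p.1 = 1) ∧ 2 ≤ p.2) ∨ (p.1 ≤ -1 ∧ (p.2 = 0 ∨ p.2 = 1)))

/-- The `L¹` distance on `ℤ²`. -/
def dist1 (u v : ℤ × ℤ) : ℤ := |u.1 - v.1| + |u.2 - v.2|

/-- The pair `(u,v)` is a slow edge, i.e. belongs to `𝒰`. -/
def slowPair (u v : ℤ × ℤ) : Prop :=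
  inU u ∧ inU v ∧ dist1 u v = 1 ∧
    ((|u.1 - v.1| = 1 ∧ 2 ≤ u.2 ∧ 2 ≤ v.2) ∨ (|u.2 - v.2| = 1 ∧ u.1 ≤ -1 ∧ v.1 ≤ -1))

open Classical in
/-- The jump rates `c_n(u,v)` of the two-dimensional random walk on `V`:
`α/n` along slow edges, `1` along other nearest-neighbour edges, `0` otherwise. -/
noncomputable def cRate (α : ℝ) (n : ℕ) (u v : ℤ × ℤ) : ℝ :=
  if slowPair u v then α / n else if dist1 u v = 1 then 1 else 0

/-- The set `V = {(x,y) ∈ ℤ² : y ≥ x+1}` as a type. -/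
abbrev Vslice : Type := {p : ℤ × ℤ // p.1 + 1 ≤ p.2}

/-- The operator exponential `e^{tA}` of a bounded operator `A`, applied to `f`:
`e^{tA} f = ∑_k (t^k / k!) A^k f`. -/
noncomputable def expApply {E : Type*} [NormedAddCommGroup E] [NormedSpace ℝ E]
    (A : E →L[ℝ] E) (t : ℝ) (f : E) : E :=
  ∑' k : ℕ, (t ^ k / (k.factorial : ℝ)) • ((A ^ k) f)

open Classical

/-- One term of the generator at `u`, extended by zero outside `V`. -/
noncomputable def genTerm (α : ℝ) (n : ℕ) (F : ℤ × ℤ → ℝ) (u v : ℤ × ℤ) : ℝ :=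
  if v.1 + 1 ≤ v.2 then cRate α n u v * (F v - F u) else 0

lemma cRate_eq_zero (α : ℝ) (n : ℕ) (u v : ℤ × ℤ) (h : dist1 u v ≠ 1) : cRate α n u v = 0 := by
  unfold cRate
  rw [if_neg (fun hs => h hs.2.2.1), if_neg h]

lemma dist1_eq_one {u v : ℤ × ℤ} (h : dist1 u v = 1) :
    v = (u.1 + 1, u.2) ∨ v = (u.1 - 1, u.2) ∨ v = (u.1, u.2 + 1) ∨ v = (u.1, u.2 - 1) := by
  obtain ⟨a, b⟩ := u
  obtain ⟨c, d⟩ := v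
  simp only [dist1, Prod.mk.injEq] at *
  rcases abs_cases (a - c) with h1 | h1 <;> rcases abs_cases (b - d) with h2 | h2 <;> omega

lemma gen_tsum (α : ℝ) (n : ℕ) (F : ℤ × ℤ → ℝ) (u : ℤ × ℤ) :
    ∑' v : Vslice, cRate α n u v.1 * (F v.1 - F u) =
      genTerm α n F u (u.1 + 1, u.2) + genTerm α n F u (u.1 - 1, u.2)
      + genTerm α n F u (u.1, u.2 + 1) + genTerm α n F u (u.1, u.2 - 1) := by
  have h1 : ∑' v : Vslice, cRate α n u v.1 * (F v.1 - F u) = ∑' v : ℤ × ℤ, genTerm α n F u v := by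
    have := tsum_subtype {p : ℤ × ℤ | p.1 + 1 ≤ p.2} (fun v => cRate α n u v * (F v - F u))
    refine Eq.trans this ?_
    refine tsum_congr fun v => ?_
    simp only [Set.indicator, genTerm, Set.mem_ofPred_eq]
  rw [h1, tsum_eq_sum (s := {(u.1 + 1, u.2), (u.1 - 1, u.2), (u.1, u.2 + 1), (u.1, u.2 - 1)})]
  · rw [Finset.sum_insert, Finset.sum_insert, Finset.sum_insert, Finset.sum_singleton]
    · ring
    all_goals
      simp only [Finset.mem_insert, Finset.mem_singleton, Prod.mk.injEq]
      omega
  · intro v hv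
    have : dist1 u v ≠ 1 := by
      intro h
      apply hv
      simpa using dist1_eq_one h
    simp [genTerm, cRate_eq_zero α n u v this]

lemma cRate_right (α : ℝ) (n : ℕ) (x y : ℤ) (h : x + 2 ≤ y) :
    cRate α n (x, y) (x + 1, y) = if x = 0 ∧ 2 ≤ y then α / n else 1 := by
  have h1 : slowPair (x, y) (x + 1, y) ↔ (x = 0 ∧ 2 ≤ y) := by
    simp [slowPair, inU, inV, dist1]; omega
  have h2 : dist1 (x, y) (x + 1, y) = 1 := by simp [dist1]
  simp only [cRate, h1, h2, if_true]

lemma cRate_left (α : ℝ) (n : ℕ) (x y : ℤ) (h : x + 1 ≤ y) :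
    cRate α n (x, y) (x - 1, y) = if x = 1 ∧ 2 ≤ y then α / n else 1 := by
  have h1 : slowPair (x, y) (x - 1, y) ↔ (x = 1 ∧ 2 ≤ y) := by
    simp [slowPair, inU, inV, dist1]; omega
  have h2 : dist1 (x, y) (x - 1, y) = 1 := by simp [dist1]
  simp only [cRate, h1, h2, if_true]

lemma cRate_up (α : ℝ) (n : ℕ) (x y : ℤ) (h : x + 1 ≤ y) :
    cRate α n (x, y) (x, y + 1) = if y = 0 ∧ x ≤ -1 then α / n else 1 := by
  have h1 : slowPair (x, y) (x, y + 1) ↔ (y = 0 ∧ x ≤ -1) := by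
    simp [slowPair, inU, inV, dist1]; omega
  have h2 : dist1 (x, y) (x, y + 1) = 1 := by simp [dist1]
  simp only [cRate, h1, h2, if_true]

lemma cRate_down (α : ℝ) (n : ℕ) (x y : ℤ) (h : x + 2 ≤ y) :
    cRate α n (x, y) (x, y - 1) = if y = 1 ∧ x ≤ -1 then α / n else 1 := by
  have h1 : slowPair (x, y) (x, y - 1) ↔ (y = 1 ∧ x ≤ -1) := by
    simp [slowPair, inU, inV, dist1]; omega
  have h2 : dist1 (x, y) (x, y - 1) = 1 := by simp [dist1]
  simp only [cRate, h1, h2, if_true]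

/-- Concave truncated profile. -/
noncomputable def prof (N : ℝ) (x : ℤ) : ℝ := (N ^ 2 - (max (N - |(x : ℝ)|) 0) ^ 2) / N

lemma prof_neg (N : ℝ) (x : ℤ) : prof N (-x) = prof N x := by simp [prof]

lemma prof_nonneg (N : ℝ) (hN : 0 < N) (x : ℤ) : 0 ≤ prof N x := by
  unfold prof
  have h1 : max (N - |(x : ℝ)|) 0 ≤ N := max_le (by linarith [abs_nonneg (x : ℝ)]) hN.le
  have h2 : 0 ≤ max (N - |(x : ℝ)|) 0 := le_max_right _ _
  apply div_nonneg _ hN.le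
  nlinarith

lemma prof_le (N : ℝ) (hN : 0 < N) (x : ℤ) : prof N x ≤ N := by
  unfold prof
  rw [div_le_iff₀ hN]
  nlinarith [sq_nonneg (max (N - |(x : ℝ)|) 0)]

lemma prof_mono (N : ℝ) (hN : 0 < N) (x : ℤ) (hx : 0 ≤ x) : prof N x ≤ prof N (x + 1) := by
  unfold prof
  have hx' : (0 : ℝ) ≤ x := by exact_mod_cast hx
  push_cast
  rw [abs_of_nonneg hx', abs_of_nonneg (by linarith : (0 : ℝ) ≤ x + 1)]
  gcongr
  linarith

lemma prof_second (N : ℝ) (hN : 0 < N) (x : ℤ) :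
    -(2 / N) ≤ prof N (x + 1) + prof N (x - 1) - 2 * prof N x := by
  have key : ∀ y : ℤ, 1 ≤ y → -(2 / N) ≤ prof N (y + 1) + prof N (y - 1) - 2 * prof N y := by
    intro y hy
    have hy' : (1 : ℝ) ≤ y := by exact_mod_cast hy
    unfold prof
    push_cast
    rw [abs_of_nonneg (by linarith : (0 : ℝ) ≤ y), abs_of_nonneg (by linarith : (0 : ℝ) ≤ y + 1),
      abs_of_nonneg (by linarith : (0 : ℝ) ≤ (y : ℝ) - 1)]
    have : (max (N - (y + 1 : ℝ)) 0) ^ 2 + (max (N - (y - 1 : ℝ)) 0) ^ 2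
        - 2 * (max (N - (y : ℝ)) 0) ^ 2 ≤ 2 := by
      rcases max_cases (N - (y + 1 : ℝ)) 0 with h1 | h1 <;>
      rcases max_cases (N - (y - 1 : ℝ)) 0 with h2 | h2 <;>
      rcases max_cases (N - (y : ℝ)) 0 with h3 | h3 <;>
      rw [h1.1, h2.1, h3.1] <;> nlinarith
    rw [← sub_nonneg]
    have e : ∀ a b c : ℝ, (N ^ 2 - a) / N + (N ^ 2 - b) / N - 2 * ((N ^ 2 - c) / N) - -(2 / N)
        = (2 - (a + b - 2 * c)) / N := by
      intro a b c; field_simp; ring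
    rw [e]
    apply div_nonneg _ hN.le
    linarith
  rcases lt_trichotomy x 0 with h | h | h
  · have := key (-x) (by omega)
    rw [show -x + 1 = -(x - 1) by ring, show -x - 1 = -(x + 1) by ring] at this
    simp only [prof_neg] at this
    linarith
  · subst h
    have h1 := prof_mono N hN 0 le_rfl
    have h2 : prof N (0 - 1) = prof N (0 + 1) := by
      rw [← prof_neg]; norm_num
    have : 0 ≤ 2 / N := by positivity
    rw [h2]
    clear h2 key
    generalize prof N (0 + 1) = p at *
    generalize prof N 0 = q at *
    generalize 2 / N = r at *
    linarith
  · exact key x (by omega)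

lemma prof_step (N : ℝ) (hN : 4 ≤ N) (x : ℤ) (hx : 0 ≤ x) (hx2 : x ≤ 2) :
    3 / 4 ≤ prof N (x + 1) - prof N x ∧ prof N (x + 1) - prof N x ≤ 2 := by
  have hx' : (0 : ℝ) ≤ x := by exact_mod_cast hx
  have hx2' : (x : ℝ) ≤ 2 := by exact_mod_cast hx2
  unfold prof
  push_cast
  rw [abs_of_nonneg hx', abs_of_nonneg (by linarith : (0 : ℝ) ≤ x + 1),
    max_eq_left (by linarith), max_eq_left (by linarith), ← sub_div]
  have h0 : 0 < N := by linarith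
  rw [le_div_iff₀ h0, div_le_iff₀ h0]
  constructor <;> nlinarith

/-- The Lyapunov function. -/
noncomputable def lyap (N : ℝ) (p : ℤ × ℤ) : ℝ := prof N p.1 + prof N p.2

lemma lyap_bound (α : ℝ) (hα : 0 < α) (n : ℕ) (hn : 1 ≤ n) (x y : ℤ) (h : x + 1 ≤ y) :
    3 / 4 * (if inU (x, y) then 1 else 0) - (2 + 2 * α) / n ≤
      genTerm α n (lyap (4 * n)) (x, y) (x + 1, y) + genTerm α n (lyap (4 * n)) (x, y) (x - 1, y)
      + genTerm α n (lyap (4 * n)) (x, y) (x, y + 1)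
      + genTerm α n (lyap (4 * n)) (x, y) (x, y - 1) := by
  have hn' : (1 : ℝ) ≤ n := by exact_mod_cast hn
  set N : ℝ := 4 * n with hN
  have hN4 : 4 ≤ N := by linarith
  have hN0 : 0 < N := by linarith
  have T1 : genTerm α n (lyap N) (x, y) (x + 1, y) =
      if x + 2 ≤ y then (if x = 0 ∧ 2 ≤ y then α / n else 1) * (prof N (x + 1) - prof N x)
      else 0 := by
    by_cases h2 : x + 2 ≤ y
    · simp only [genTerm, lyap]
      rw [if_pos (by omega), if_pos h2, cRate_right α n x y h2]
      ring
    · simp only [genTerm]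
      rw [if_neg (by omega), if_neg h2]
  have T2 : genTerm α n (lyap N) (x, y) (x - 1, y) =
      (if x = 1 ∧ 2 ≤ y then α / n else 1) * (prof N (x - 1) - prof N x) := by
    simp only [genTerm, lyap]
    rw [if_pos (by omega), cRate_left α n x y h]
    ring
  have T3 : genTerm α n (lyap N) (x, y) (x, y + 1) =
      (if y = 0 ∧ x ≤ -1 then α / n else 1) * (prof N (y + 1) - prof N y) := by
    simp only [genTerm, lyap]
    rw [if_pos (by omega), cRate_up α n x y h]
    ring
  have T4 : genTerm α n (lyap N) (x, y) (x, y - 1) =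
      if x + 2 ≤ y then (if y = 1 ∧ x ≤ -1 then α / n else 1) * (prof N (y - 1) - prof N y)
      else 0 := by
    by_cases h2 : x + 2 ≤ y
    · simp only [genTerm, lyap]
      rw [if_pos (by omega), if_pos h2, cRate_down α n x y h2]
      ring
    · simp only [genTerm]
      rw [if_neg (by omega), if_neg h2]
  rw [T1, T2, T3, T4]
  clear T1 T2 T3 T4
  have ha : 0 < α / n := by positivity
  have he : 0 < 1 / (n : ℝ) := by positivity
  have hc : (2 + 2 * α) / n = 2 * (1 / (n : ℝ)) + 2 * (α / n) := by ring
  have h2N : 2 / N = 1 / 2 * (1 / (n : ℝ)) := by rw [hN]; field_simp; norm_num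
  have Sx := prof_second N hN0 x
  have Sy := prof_second N hN0 y
  rw [h2N] at Sx Sy
  rw [hc]
  have P0 := prof_step N hN4 0 (by norm_num) (by norm_num)
  have P1 := prof_step N hN4 1 (by norm_num) (by norm_num)
  have P2 := prof_step N hN4 2 (by norm_num) (by norm_num)
  have m1 := prof_neg N 1
  have m2 := prof_neg N 2
  have hU : inU (x, y) ↔ (((x = 0 ∨ x = 1) ∧ 2 ≤ y) ∨ (x ≤ -1 ∧ (y = 0 ∨ y = 1))) := by
    simp [inU, inV, h]
  simp only [hU]
  clear hU
  generalize α / (n : ℝ) = a at *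
  generalize 1 / (n : ℝ) = e at *
  norm_num at P0 P1 P2
  have Q0 : a * (prof N 1 - prof N 0) ≤ a * 2 := mul_le_mul_of_nonneg_left (by linarith) ha.le
  have Q1 : 0 ≤ a * (prof N 1 - prof N 0) := mul_nonneg ha.le (by linarith)
  by_cases hd : x + 2 ≤ y
  · by_cases c1 : x = 0
    · subst c1
      split_ifs <;> first | (exfalso; omega) | (norm_num at Sx ⊢; linarith)
    by_cases c2 : x = 1
    · subst c2
      split_ifs <;> first | (exfalso; omega) | (norm_num at Sx ⊢; linarith)
    by_cases c3 : y = 0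
    · subst c3
      split_ifs <;> first | (exfalso; omega) | (norm_num at Sy ⊢; linarith)
    by_cases c4 : y = 1
    · subst c4
      split_ifs <;> first | (exfalso; omega) | (norm_num at Sy ⊢; linarith)
    rw [if_neg (by omega), if_pos hd, if_neg (by omega), if_neg (by omega), if_neg (by omega),
      if_pos hd, if_neg (by omega)]
    linarith
  · have hy : y = x + 1 := by omega
    subst hy
    rw [if_neg hd, if_neg hd]
    rw [show x + 1 + 1 = x + 2 by ring] at *
    rw [show x + 1 - 1 = x by ring] at Sy
    by_cases c1 : x = 0
    · subst c1
      split_ifs <;> first | (exfalso; omega) | (norm_num at Sx ⊢; linarith)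
    by_cases c2 : x = 1
    · subst c2
      split_ifs <;> first | (exfalso; omega) | (norm_num at Sx ⊢; linarith)
    by_cases c3 : x = -1
    · subst c3
      split_ifs <;> first | (exfalso; omega) | (norm_num at Sx ⊢; linarith)
    rw [if_neg (by omega), if_neg (by omega), if_neg (by omega)]
    linarith

section abstractSemigroup

variable {E : Type*} [NormedAddCommGroup E] [NormedSpace ℝ E] [CompleteSpace E]

lemma expApply_eq_exp (A : E →L[ℝ] E) (t : ℝ) (f : E) :
    expApply A t f = (NormedSpace.exp (t • A)) f := by
  have h := NormedSpace.exp_series_hasSum_exp' (𝕂 := ℝ) (t • A)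
  have h2 := (ContinuousLinearMap.apply ℝ E f).hasSum h
  unfold expApply
  refine Eq.trans ?_ h2.tsum_eq
  refine tsum_congr fun k => ?_
  simp [smul_pow, smul_smul, div_eq_inv_mul]

lemma expApply_hasSum (A : E →L[ℝ] E) (t : ℝ) (f : E) :
    HasSum (fun k : ℕ => (t ^ k / (k.factorial : ℝ)) • ((A ^ k) f)) (expApply A t f) := by
  have h := NormedSpace.exp_series_hasSum_exp' (𝕂 := ℝ) (t • A)
  have h2 := (ContinuousLinearMap.apply ℝ E f).hasSum h
  rw [expApply_eq_exp]
  change HasSum _ (ContinuousLinearMap.apply ℝ E f (NormedSpace.exp (t • A)))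
  convert h2 using 2 with k
  simp [smul_pow, smul_smul, div_eq_inv_mul]

lemma expApply_sub (A : E →L[ℝ] E) (t : ℝ) (f g : E) :
    expApply A t (f - g) = expApply A t f - expApply A t g := by
  simp only [expApply_eq_exp, map_sub]

lemma expApply_smul (A : E →L[ℝ] E) (t c : ℝ) (f : E) :
    expApply A t (c • f) = c • expApply A t f := by
  simp only [expApply_eq_exp, map_smul]

lemma expApply_zero (A : E →L[ℝ] E) (f : E) : expApply A 0 f = f := by
  simp [expApply_eq_exp]

lemma expApply_apply_zero (A : E →L[ℝ] E) (t : ℝ) : expApply A t 0 = 0 := by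
  simp [expApply_eq_exp]

lemma expApply_hasDerivAt (A : E →L[ℝ] E) (L : E →L[ℝ] ℝ) (f : E) (s : ℝ) :
    HasDerivAt (fun r => L (expApply A r f)) (L (expApply A s (A f))) s := by
  simp only [expApply_eq_exp]
  have h := hasDerivAt_exp_smul_const (𝕂 := ℝ) A s
  exact (L.comp (ContinuousLinearMap.apply ℝ E f)).hasFDerivAt.comp_hasDerivAt s h

lemma expApply_shift (A : E →L[ℝ] E) (l s : ℝ) (f : E) :
    expApply A s f = Real.exp (-(s * l)) • expApply (A + l • 1) s f := by
  have hdec : s • A = algebraMap ℝ _ (-(s * l)) + s • (A + l • 1) := by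
    simp only [Algebra.algebraMap_eq_smul_one, smul_add, smul_smul]
    module
  let _ : NormedAlgebra ℚ (E →L[ℝ] E) := NormedAlgebra.restrictScalars ℚ ℝ _
  rw [expApply_eq_exp, expApply_eq_exp, hdec,
    NormedSpace.exp_add_of_commute (Algebra.commutes _ _),
    ← NormedSpace.algebraMap_exp_comm, ← Real.exp_eq_exp_ℝ]
  simp only [Algebra.algebraMap_eq_smul_one, smul_mul_assoc, one_mul,
    smul_apply]

end abstractSemigroup

lemma exp_nonneg_of_shift {X : Type*} [TopologicalSpace X]
    (B : (X →ᵇ ℝ) →L[ℝ] (X →ᵇ ℝ)) (l : ℝ)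
    (hB : ∀ f : X →ᵇ ℝ, (∀ x, 0 ≤ f x) → ∀ x, 0 ≤ B f x + l * f x)
    (s : ℝ) (hs : 0 ≤ s) (f : X →ᵇ ℝ) (hf : ∀ x, 0 ≤ f x) (x : X) :
    0 ≤ expApply B s f x := by
  rw [expApply_shift B l]
  set A : (X →ᵇ ℝ) →L[ℝ] (X →ᵇ ℝ) := B + l • 1 with hA
  have hAf : ∀ g : X →ᵇ ℝ, ∀ x, A g x = B g x + l * g x := by
    intro g x
    simp [hA]
  have hpow : ∀ k : ℕ, ∀ x, 0 ≤ (A ^ k) f x := by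
    intro k
    induction k with
    | zero => simpa using hf
    | succ k ih =>
      intro x
      rw [pow_succ', mul_apply_eq_comp, hAf]
      exact hB _ ih x
  have hpos : 0 ≤ expApply A s f x := by
    have h2 := (BoundedContinuousFunction.evalCLM ℝ x).hasSum (expApply_hasSum A s f)
    refine h2.nonneg fun k => ?_
    have := hpow k x
    rw [map_smul]
    exact mul_nonneg (by positivity) this
  exact mul_nonneg (Real.exp_pos _).le hpos

lemma gen_shift_nonneg (α : ℝ) (hα : 0 < α) (n : ℕ) (hn : 1 ≤ n)
    (B : (Vslice →ᵇ ℝ) →L[ℝ] (Vslice →ᵇ ℝ))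
    (hB : ∀ f : Vslice →ᵇ ℝ, ∀ u : Vslice,
          B f u = ∑' v : Vslice, cRate α n u.1 v.1 * (f v - f u))
    (f : Vslice →ᵇ ℝ) (hf : ∀ x, 0 ≤ f x) (u : Vslice) :
    0 ≤ B f u + 4 * (1 + α) * f u := by
  have hn' : (1 : ℝ) ≤ n := by exact_mod_cast hn
  let F : ℤ × ℤ → ℝ := fun p => if h : p.1 + 1 ≤ p.2 then f ⟨p, h⟩ else 0
  have hF : ∀ v : Vslice, F v.1 = f v := fun v => by simp only [F]; rw [dif_pos v.2]
  have hF0 : ∀ p, 0 ≤ F p := by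
    intro p
    simp only [F]
    split_ifs
    · exact hf _
    · exact le_rfl
  have e : B f u = ∑' v : Vslice, cRate α n u.1 v.1 * (F v.1 - F u.1) := by
    rw [hB]; simp only [hF]
  have hk : ∀ v, -((1 + α) * F u.1) ≤ genTerm α n F u.1 v := by
    intro v
    have h1 : α / n ≤ α := div_le_self hα.le hn'
    have h2 : 0 ≤ α / n := by positivity
    have hc : 0 ≤ cRate α n u.1 v ∧ cRate α n u.1 v ≤ 1 + α := by
      unfold cRate
      split_ifs <;> constructor <;> linarith
    have := hF0 u.1
    have := hF0 v
    unfold genTerm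
    split_ifs
    · nlinarith [mul_nonneg hc.1 (hF0 v), mul_le_mul_of_nonneg_right hc.2 (hF0 u.1)]
    · nlinarith
  rw [e, gen_tsum, ← hF u]
  have a1 := hk (u.1.1 + 1, u.1.2)
  have a2 := hk (u.1.1 - 1, u.1.2)
  have a3 := hk (u.1.1, u.1.2 + 1)
  have a4 := hk (u.1.1, u.1.2 - 1)
  linarith

/-- **Expected number of crossings of the slow edges** (Lemma 3.5). Uniformly over the
starting point, over `n`, and over `t ∈ [0,T]`, the expected number of jumps across slow
edges performed up to time `tn²` by the random walk generated by `𝐁_n` — which equals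
`(α/n)` times the expected local time in `U` up to time `tn²` — is bounded by a constant. -/
theorem expected_crossings_bounded (α T : ℝ) (hα : 0 < α) (hT : 0 < T) :
    ∃ c : ℝ, 0 < c ∧ ∀ n : ℕ, 1 ≤ n →
      ∀ B : (Vslice →ᵇ ℝ) →L[ℝ] (Vslice →ᵇ ℝ),
        (∀ f : Vslice →ᵇ ℝ, ∀ u : Vslice,
          B f u = ∑' v : Vslice, cRate α n u.1 v.1 * (f v - f u)) →
      ∀ χU : Vslice →ᵇ ℝ, (∀ u : Vslice, χU u = if inU u.1 then 1 else 0) →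
      ∀ u : Vslice, ∀ t ∈ Set.Icc (0 : ℝ) T,
        (α / n) * ∫ s in (0 : ℝ)..(t * (n : ℝ) ^ 2), expApply B s χU u ≤ c := by
  refine ⟨4 / 3 * α * (8 + (2 + 2 * α) * T), by positivity, ?_⟩
  intro n hn B hB χU hχ u t ht
  have hn' : (1 : ℝ) ≤ n := by exact_mod_cast hn
  have hN0 : (0 : ℝ) < 4 * n := by linarith
  set C : ℝ := (2 + 2 * α) / n with hC
  have hpos := exp_nonneg_of_shift B _ (gen_shift_nonneg α hα n hn B hB)
  let ψ : Vslice →ᵇ ℝ := BoundedContinuousFunction.ofNormedAddCommGroupDiscrete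
    (fun v => lyap (4 * n) v.1) (8 * n) (by
      intro v
      have h1 := prof_nonneg (4 * n) hN0 v.1.1
      have h2 := prof_nonneg (4 * n) hN0 v.1.2
      have h3 := prof_le (4 * n) hN0 v.1.1
      have h4 := prof_le (4 * n) hN0 v.1.2
      rw [Real.norm_eq_abs, abs_le]
      unfold lyap
      constructor <;> linarith)
  have hψ : ∀ v, ψ v = lyap (4 * n) v.1 := fun v => rfl
  have hψ0 : ∀ v, 0 ≤ ψ v := by
    intro v
    rw [hψ]
    exact add_nonneg (prof_nonneg _ hN0 _) (prof_nonneg _ hN0 _)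
  have hψ8 : ∀ v, ψ v ≤ 8 * n := by
    intro v
    rw [hψ]
    have h3 := prof_le (4 * n) hN0 v.1.1
    have h4 := prof_le (4 * n) hN0 v.1.2
    unfold lyap; linarith
  have hBψ : ∀ v, 3 / 4 * χU v - C ≤ B ψ v := by
    intro v
    rw [hB, hχ]
    simp only [hψ]
    rw [gen_tsum]
    exact lyap_bound α hα n hn v.1.1 v.1.2 v.2
  have hderiv : ∀ f : Vslice →ᵇ ℝ, ∀ s : ℝ,
      HasDerivAt (fun r => expApply B r f u) (expApply B s (B f) u) s := by
    intro f s
    exact expApply_hasDerivAt B (BoundedContinuousFunction.evalCLM ℝ u) f s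
  have hcont : ∀ f : Vslice →ᵇ ℝ, Continuous (fun r => expApply B r f u) := fun f =>
    continuous_iff_continuousAt.2 fun s => (hderiv f s).continuousAt
  have hP0 : ∀ f : Vslice →ᵇ ℝ, expApply B 0 f = f := fun f => expApply_zero B f
  let one : Vslice →ᵇ ℝ := BoundedContinuousFunction.const _ 1
  have hBone : B one = 0 := by
    ext v
    rw [hB]
    simp [one]
  have hPone : ∀ s, expApply B s one u = 1 := by
    intro s
    have h : ∀ r, HasDerivAt (fun r => expApply B r one u) 0 r := by
      intro r
      have := hderiv one r
      rw [hBone, expApply_apply_zero] at this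
      exact this
    have := is_const_of_deriv_eq_zero (fun r => (h r).differentiableAt) (fun r => (h r).deriv) s 0
    simp only [hP0] at this
    rw [this]; rfl
  have hmono : ∀ f g : Vslice →ᵇ ℝ, (∀ v, f v ≤ g v) → ∀ s, 0 ≤ s → expApply B s f u ≤ expApply B s g u := by
    intro f g hfg s hs
    have := hpos s hs (g - f) (fun v => by simpa using hfg v) u
    rw [expApply_sub] at this
    simpa using this
  set τ : ℝ := t * (n : ℝ) ^ 2 with hτ
  have hτ0 : 0 ≤ τ := mul_nonneg ht.1 (by positivity)
  have ftc : ∫ s in (0 : ℝ)..τ, expApply B s (B ψ) u = expApply B τ ψ u - expApply B 0 ψ u :=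
    intervalIntegral.integral_eq_sub_of_hasDerivAt (fun s _ => hderiv ψ s)
      ((hcont (B ψ)).intervalIntegrable _ _)
  have hle : ∫ s in (0 : ℝ)..τ, (3 / 4 * expApply B s χU u - C) ≤ ∫ s in (0 : ℝ)..τ, expApply B s (B ψ) u := by
    apply intervalIntegral.integral_mono_on hτ0
    · exact (((hcont χU).const_mul _).sub continuous_const).intervalIntegrable _ _
    · exact (hcont (B ψ)).intervalIntegrable _ _
    · intro s hs
      have := hmono ((3 / 4 : ℝ) • χU - C • one) (B ψ) (fun v => by simpa [one] using hBψ v) s hs.1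
      rw [expApply_sub, expApply_smul, expApply_smul] at this
      simpa [hPone] using this
  rw [intervalIntegral.integral_sub (((hcont χU).const_mul _).intervalIntegrable _ _)
    (continuous_const.intervalIntegrable _ _), intervalIntegral.integral_const_mul,
    intervalIntegral.integral_const, ftc, hP0] at hle
  have hup : expApply B τ ψ u ≤ 8 * n := by
    have := hmono ψ ((8 * n : ℝ) • one) (fun v => by simpa [one] using hψ8 v) τ hτ0
    rw [expApply_smul] at this
    simpa [hPone] using this
  have h0 := hψ0 u
  have hCτ : C * τ ≤ (2 + 2 * α) * T * n := by
    rw [hC, hτ]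
    have : (2 + 2 * α) / (n : ℝ) * (t * (n : ℝ) ^ 2) = (2 + 2 * α) * t * n := by
      field_simp
    rw [this]
    have := ht.2
    gcongr
  simp only [sub_zero, smul_eq_mul] at hle
  have hfin : ∫ s in (0 : ℝ)..τ, expApply B s χU u ≤ 4 / 3 * (8 + (2 + 2 * α) * T) * n := by
    linarith
  calc α / n * ∫ s in (0 : ℝ)..τ, expApply B s χU u
      ≤ α / n * (4 / 3 * (8 + (2 + 2 * α) * T) * n) :=
        mul_le_mul_of_nonneg_left hfin (by positivity)
    _ = 4 / 3 * α * (8 + (2 + 2 * α) * T) := by field_simp
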